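/- arXiv:2501.00754 — 5 statements merged into one kernel-verified Lean document; each statement's English description precedes it below -/
import Mathlib

section
/- Let X be a measurable space, D a probability measure on X, and H a finite set of measurable hypotheses h : X → Bool containing the target concept c. Fix ε ∈ (0,1) and δ ∈ (0,1). If the sample size m satisfies m ≥ (1/ε)·ln(|H|/δ), then with probability at least 1−δ over an i.i.d. sample x₁,…,xₘ drawn from D^m, every hypothesis h ∈ H that is consistent with the labeled sample (i.e., h(xᵢ) = c(xᵢ) for all i = 1,…,m) has generalization error R(h,c) ≤ ε. In other words, a learner that outputs any consistent hypothesis is an (ε,δ)-PAC learner for sample sizes m ≥ (1/ε)·ln(|H|/δ). -/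
open MeasureTheory

/-- Generalization error `R(h,c) = D {x | h x ≠ c x}`. -/
noncomputable def genError {X : Type*} [MeasurableSpace X] (D : Measure X)
    (h c : X → Bool) : ENNReal :=
  D {x | h x ≠ c x}

/-- A sample of size `m` is consistent with a hypothesis of error more than `ε` with probability
at most `exp (-ε m)`. -/
theorem measure_pi_consistent_le {X : Type*} [MeasurableSpace X] (D : Measure X)
    [IsProbabilityMeasure D] {h c : X → Bool} (hh : Measurable h) (hc : Measurable c)
    {ε : ℝ} (hε : 0 ≤ ε) (hbad : ENNReal.ofReal ε < genError D h c) (m : ℕ) :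
    (Measure.pi fun _ : Fin m => D) {xs | ∀ i, h (xs i) = c (xs i)} ≤
      ENNReal.ofReal (Real.exp (-(ε * m))) := by
  have hset : {xs : Fin m → X | ∀ i, h (xs i) = c (xs i)} =
      Set.univ.pi fun _ => {x | h x = c x} := by
    ext xs
    simp
  have hcompl : {x | h x = c x} = {x | h x ≠ c x}ᶜ := by
    ext x
    simp
  have hmeas : MeasurableSet {x | h x ≠ c x} := (measurableSet_eq_fun hh hc).compl
  have hD : D {x | h x = c x} ≤ ENNReal.ofReal (Real.exp (-ε)) := by
    rw [hcompl, prob_compl_eq_one_sub hmeas]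
    calc 1 - D {x | h x ≠ c x} ≤ 1 - ENNReal.ofReal ε := tsub_le_tsub_left hbad.le 1
      _ = ENNReal.ofReal (1 - ε) := by rw [ENNReal.ofReal_sub 1 hε, ENNReal.ofReal_one]
      _ ≤ ENNReal.ofReal (Real.exp (-ε)) :=
        ENNReal.ofReal_le_ofReal (Real.one_sub_le_exp_neg ε)
  rw [hset, Measure.pi_pi, Finset.prod_const, Finset.card_univ, Fintype.card_fin]
  calc D {x | h x = c x} ^ m ≤ ENNReal.ofReal (Real.exp (-ε)) ^ m := by gcongr
    _ = ENNReal.ofReal (Real.exp (-(ε * m))) := by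
      rw [← ENNReal.ofReal_pow (Real.exp_nonneg _), ← Real.exp_nat_mul]
      congr 2
      ring

/-- for sample size `m ≥ (1/ε)·ln(|H|/δ)`, with probability at least `1-δ`
over an i.i.d. sample from `D^m`, every hypothesis in the finite class `H` that is
consistent with the sample labeled by the target `c ∈ H` has generalization error `≤ ε`. -/
theorem consistent_learner_is_PAC
    {X : Type*} [MeasurableSpace X] (D : Measure X) [IsProbabilityMeasure D]
    (H : Finset (X → Bool)) (c : X → Bool) (hcH : c ∈ H)
    (hHmeas : ∀ h ∈ H, Measurable h)
    (ε δ : ℝ) (hε : ε ∈ Set.Ioo (0 : ℝ) 1) (hδ : δ ∈ Set.Ioo (0 : ℝ) 1)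
    (m : ℕ) (hm : (1 / ε) * Real.log ((H.card : ℝ) / δ) ≤ (m : ℝ)) :
    ENNReal.ofReal (1 - δ) ≤
      (Measure.pi fun _ : Fin m => D)
        {xs : Fin m → X | ∀ h ∈ H,
          (∀ i : Fin m, h (xs i) = c (xs i)) →
            genError D h c ≤ ENNReal.ofReal ε} := by
  classical
  set μ := Measure.pi fun _ : Fin m => D
  set good := {xs : Fin m → X | ∀ h ∈ H, (∀ i : Fin m, h (xs i) = c (xs i)) →
    genError D h c ≤ ENNReal.ofReal ε}
  have hcard : (0 : ℝ) < H.card := by exact_mod_cast Finset.card_pos.mpr ⟨c, hcH⟩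
  have hexp : H.card * Real.exp (-(ε * m)) ≤ δ := by
    have hlog : Real.log (H.card / δ) ≤ ε * m := by
      rwa [one_div, inv_mul_le_iff₀ hε.1] at hm
    have hle := (Real.log_le_iff_le_exp (div_pos hcard hδ.1)).mp hlog
    rw [Real.exp_neg, ← div_eq_mul_inv, div_le_iff₀ (Real.exp_pos _)]
    rwa [div_le_iff₀' hδ.1] at hle
  have hsub : goodᶜ ⊆ ⋃ h ∈ H.filter fun h => ENNReal.ofReal ε < genError D h c,
      {xs | ∀ i, h (xs i) = c (xs i)} := by
    intro xs hxs
    simp only [good, Set.mem_compl_iff, Set.mem_ofPred_eq, not_forall, not_le] at hxs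
    obtain ⟨h, hh, hcons, hbad⟩ := hxs
    exact Set.mem_biUnion (Finset.mem_filter.mpr ⟨hh, hbad⟩) hcons
  have hbound : μ goodᶜ ≤ ENNReal.ofReal δ := by
    calc μ goodᶜ
        ≤ ∑ h ∈ H.filter fun h => ENNReal.ofReal ε < genError D h c,
            μ {xs | ∀ i, h (xs i) = c (xs i)} :=
          (measure_mono hsub).trans (measure_biUnion_finset_le _ _)
      _ ≤ ∑ _h ∈ H.filter fun h => ENNReal.ofReal ε < genError D h c,
            ENNReal.ofReal (Real.exp (-(ε * m))) := by
          refine Finset.sum_le_sum fun h hh => ?_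
          obtain ⟨hhH, hbad⟩ := Finset.mem_filter.mp hh
          exact measure_pi_consistent_le D (hHmeas h hhH) (hHmeas c hcH) hε.1.le hbad m
      _ ≤ ∑ _h ∈ H, ENNReal.ofReal (Real.exp (-(ε * m))) :=
          Finset.sum_le_sum_of_subset (Finset.filter_subset _ _)
      _ = ENNReal.ofReal (H.card * Real.exp (-(ε * m))) := by
          rw [Finset.sum_const, nsmul_eq_mul, ENNReal.ofReal_mul hcard.le,
            ENNReal.ofReal_natCast]
      _ ≤ ENNReal.ofReal δ := ENNReal.ofReal_le_ofReal hexp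
  rw [ENNReal.ofReal_sub 1 hδ.1.le, ENNReal.ofReal_one, tsub_le_iff_right]
  calc 1 = μ (good ∪ goodᶜ) := by rw [Set.union_compl_self, measure_univ]
    _ ≤ μ good + μ goodᶜ := measure_union_le _ _
    _ ≤ μ good + ENNReal.ofReal δ := by gcongr
end

section
/- Let X be a measurable space, D a probability measure on X, and h, c : X → Bool measurable functions with generalization error R(h,c) > ε for some ε ∈ (0,1). Then the probability, under the m-fold product measure D^m, that h is consistent with all m labeled examples (i.e., h(xᵢ) = c(xᵢ) for every i = 1,…,m) is at most (1−ε)^m, which is at most e^{−εm}. -/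
open MeasureTheory

/-- The probability that `h` and `c` agree is one minus the generalization error. -/
theorem measure_agree_eq_one_sub_genError {X : Type*} [MeasurableSpace X] (D : Measure X)
    [IsProbabilityMeasure D] {h c : X → Bool} (hh : Measurable h) (hc : Measurable c) :
    D {x | h x = c x} = 1 - genError D h c := by
  have hset : {x | h x = c x} = {x | h x ≠ c x}ᶜ := by
    ext x
    simp
  have hmeas : MeasurableSet {x | h x ≠ c x} := (measurableSet_eq_fun hh hc).compl
  rw [hset, prob_compl_eq_one_sub hmeas, genError]

/-- The event that all coordinates agree has product probability equal to the power. -/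
theorem measure_pi_forall_agree {X : Type*} [MeasurableSpace X] (D : Measure X)
    [IsProbabilityMeasure D] (h c : X → Bool) (m : ℕ) :
    (Measure.pi fun _ : Fin m => D) {xs : Fin m → X | ∀ i : Fin m, h (xs i) = c (xs i)}
      = D {x | h x = c x} ^ m := by
  have hset : {xs : Fin m → X | ∀ i : Fin m, h (xs i) = c (xs i)}
      = Set.univ.pi fun _ => {x | h x = c x} := by
    ext xs
    simp
  rw [hset, Measure.pi_pi]
  simp

/-- if `R(h,c) > ε`, the probability under `D^m` that `h` is consistent
with all `m` labeled examples is at most `(1-ε)^m ≤ e^{-εm}`. -/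
theorem bad_hypothesis_consistency_bound
    {X : Type*} [MeasurableSpace X] (D : Measure X) [IsProbabilityMeasure D]
    (h c : X → Bool) (hh : Measurable h) (hc : Measurable c)
    (ε : ℝ) (hε : ε ∈ Set.Ioo (0 : ℝ) 1)
    (hR : ENNReal.ofReal ε < genError D h c) (m : ℕ) :
    (Measure.pi fun _ : Fin m => D) {xs : Fin m → X | ∀ i : Fin m, h (xs i) = c (xs i)}
        ≤ ENNReal.ofReal ((1 - ε) ^ m) ∧
      (1 - ε) ^ m ≤ Real.exp (-(ε * (m : ℝ))) := by
  have hε1 : 0 ≤ 1 - ε := sub_nonneg.2 hε.2.le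
  constructor
  · rw [measure_pi_forall_agree, measure_agree_eq_one_sub_genError D hh hc,
      ENNReal.ofReal_pow hε1, ENNReal.ofReal_sub 1 hε.1.le, ENNReal.ofReal_one]
    gcongr
  · calc (1 - ε) ^ m ≤ Real.exp (-ε) ^ m :=
          pow_le_pow_left₀ hε1 (Real.one_sub_le_exp_neg ε) m
      _ = Real.exp (-(ε * (m : ℝ))) := by
          rw [← Real.exp_nat_mul]
          congr 1
          ring
end

section
/- Let η_A, η_E ∈ [0, 1/2) with η_A < η_E, let 1 ≤ n_E ≤ n_A be dataset sizes, and let ε_A, ε_E ∈ (0,1]. If the minimal guaranteed confidence parameters coincide, i.e. e^{−γ_A·n_A} = e^{−γ_E·n_E} where γ_A = ε_A²·(1−2η_A)²/2 and γ_E = ε_E²·(1−2η_E)²/2, then necessarily ε_E > ε_A. That is, an eavesdropper matching the authorized learner's confidence guarantee must accept a strictly worse inaccuracy. -/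
/-- with `η_A < η_E` (both in `[0,1/2)`), sizes `1 ≤ n_E ≤ n_A`, and
inaccuracies `ε_A, ε_E ∈ (0,1]`, if the minimal guaranteed confidence parameters
coincide, `e^{-γ_A n_A} = e^{-γ_E n_E}`, then necessarily `ε_E > ε_A`. -/
theorem matching_confidence_forces_worse_inaccuracy
    (ηA ηE εA εE nA nE : ℝ)
    (hηA : ηA ∈ Set.Ico (0 : ℝ) (1 / 2)) (hηE : ηE ∈ Set.Ico (0 : ℝ) (1 / 2))
    (hlt : ηA < ηE)
    (hnE : 1 ≤ nE) (hnEA : nE ≤ nA)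
    (hεA : εA ∈ Set.Ioc (0 : ℝ) 1) (hεE : εE ∈ Set.Ioc (0 : ℝ) 1)
    (heq : Real.exp (-(εA ^ 2 * (1 - 2 * ηA) ^ 2 / 2) * nA) =
      Real.exp (-(εE ^ 2 * (1 - 2 * ηE) ^ 2 / 2) * nE)) :
    εA < εE := by
  by_contra! hle
  have hexp := Real.exp_injective heq
  have hE : 0 < 1 - 2 * ηE := by linarith [hηE.2]
  have hmul : εE * (1 - 2 * ηE) < εA * (1 - 2 * ηA) :=
    mul_lt_mul' hle (by linarith) hE.le hεA.1
  have hsq : (εE * (1 - 2 * ηE)) ^ 2 < (εA * (1 - 2 * ηA)) ^ 2 :=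
    pow_lt_pow_left₀ hmul (mul_pos hεE.1 hE).le two_ne_zero
  have hprod : (εE * (1 - 2 * ηE)) ^ 2 * nE < (εA * (1 - 2 * ηA)) ^ 2 * nA :=
    mul_lt_mul hsq hnEA (by linarith) (sq_nonneg _)
  linarith
end

section
/- Let X be a measurable space, D a probability measure on X, c : X → Bool a measurable target concept, H a finite set of measurable hypotheses h : X → Bool, η ∈ [0,1/2) a noise rate, and ε ∈ (0,1). Draw m i.i.d. noisy examples (x₁,b₁),…,(xₘ,bₘ) from the classification-noise measure μ_η, and for each h ∈ H let d̂(h) = (1/m)·#{i : h(xᵢ) ≠ bᵢ} denote its empirical disagreement rate, while d(h) = μ_η{(x,b) : h(x) ≠ b} denotes its true disagreement probability. Then the probability that some h ∈ H satisfies |d̂(h) − d(h)| ≥ ε·(1−2η)/2 is at most 2·|H|·e^{−m·ε²·(1−2η)²/2}. -/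
open MeasureTheory

/-- The classification-noise example measure `μ_η` on `X × Bool`. -/
noncomputable def noisyExampleMeasure {X : Type*} [MeasurableSpace X]
    (D : Measure X) (c : X → Bool) (η : ℝ) : Measure (X × Bool) :=
  D.bind fun x =>
    ENNReal.ofReal (1 - η) • Measure.dirac (x, c x) +
      ENNReal.ofReal η • Measure.dirac (x, !c x)

/-- Empirical disagreement rate of `h` on a sample `s` of `m` labeled examples. -/
noncomputable def empDisagreement {X : Type*} (m : ℕ) (h : X → Bool)
    (s : Fin m → X × Bool) : ℝ :=
  ((Finset.univ.filter fun i : Fin m => h (s i).1 ≠ (s i).2).card : ℝ) / (m : ℝ)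

/-- The classification-noise measure is a probability measure. -/
lemma isProbabilityMeasure_noisyExampleMeasure {X : Type*} [MeasurableSpace X]
    (D : Measure X) [IsProbabilityMeasure D] {c : X → Bool} (hc : Measurable c)
    {η : ℝ} (h0 : 0 ≤ η) (h1 : η ≤ 1) :
    IsProbabilityMeasure (noisyExampleMeasure D c η) := by
  have hc' : Measurable fun x => !c x := (measurable_of_countable Bool.not).comp hc
  have hmeas : Measurable fun x =>
      ENNReal.ofReal (1 - η) • Measure.dirac (x, c x) +
        ENNReal.ofReal η • Measure.dirac (x, !c x) := by
    refine Measure.measurable_of_measurable_coe _ fun s hs => ?_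
    simp only [Measure.add_apply, Measure.smul_apply, smul_eq_mul, Measure.dirac_apply' _ hs]
    have hind : Measurable (s.indicator (1 : X × Bool → ENNReal)) :=
      measurable_one.indicator hs
    exact ((hind.comp (measurable_id.prodMk hc)).const_mul _).add
      ((hind.comp (measurable_id.prodMk hc')).const_mul _)
  constructor
  rw [noisyExampleMeasure, Measure.bind_apply MeasurableSet.univ hmeas.aemeasurable]
  have hsum : ENNReal.ofReal (1 - η) + ENNReal.ofReal η = 1 := by
    rw [← ENNReal.ofReal_add (by linarith) h0]
    simp
  simp [hsum]

/-- Two-sided Hoeffding bound for the empirical frequency of an event. -/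
lemma measureReal_pi_le_abs_frequency_sub {Y : Type*} [MeasurableSpace Y] (μ : Measure Y)
    [IsProbabilityMeasure μ] {A : Set Y} [DecidablePred (· ∈ A)] (hA : MeasurableSet A)
    (m : ℕ) {t : ℝ} (ht : 0 ≤ t) :
    (Measure.pi fun _ : Fin m => μ).real
      {s : Fin m → Y | t ≤
        |((Finset.univ.filter fun i : Fin m => s i ∈ A).card : ℝ) / m - μ.real A|}
      ≤ 2 * Real.exp (-2 * m * t ^ 2) := by
  rcases Nat.eq_zero_or_pos m with rfl | hm
  · refine measureReal_le_one.trans ?_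
    norm_num
  have hm' : (0 : ℝ) < m := by exact_mod_cast hm
  let f : Y → ℝ := A.indicator 1
  have hf : Measurable f := measurable_one.indicator hA
  have hint : ∫ y, f y ∂μ = μ.real A := integral_indicator_one hA
  have hsub : ProbabilityTheory.HasSubgaussianMGF (fun y => f y - μ.real A)
      ((‖(1 : ℝ) - 0‖₊ / 2) ^ 2) μ := by
    rw [← hint]
    refine ProbabilityTheory.hasSubgaussianMGF_of_mem_Icc hf.aemeasurable (ae_of_all _ fun y => ?_)
    by_cases hy : y ∈ A <;> simp [f, hy]
  have tail : ∀ g : Y → ℝ, Measurable g →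
      ProbabilityTheory.HasSubgaussianMGF g ((‖(1 : ℝ) - 0‖₊ / 2) ^ 2) μ →
      (Measure.pi fun _ : Fin m => μ).real {s | m * t ≤ ∑ i, g (s i)}
        ≤ Real.exp (-2 * m * t ^ 2) := by
    intro g hg hgs
    have hindep : ProbabilityTheory.iIndepFun (fun (i : Fin m) (s : Fin m → Y) => g (s i))
        (Measure.pi fun _ : Fin m => μ) :=
      ProbabilityTheory.iIndepFun_pi (X := fun _ => g) fun _ => hg.aemeasurable
    refine (ProbabilityTheory.HasSubgaussianMGF.measure_sum_ge_le_of_iIndepFun hindep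
      (s := Finset.univ) (c := fun _ => (‖(1 : ℝ) - 0‖₊ / 2) ^ 2) (fun i _ => ?_)
      (by positivity)).trans (le_of_eq ?_)
    · refine ProbabilityTheory.HasSubgaussianMGF.of_map (Y := fun s : Fin m → Y => s i) (X := g)
        (measurable_pi_apply i).aemeasurable ?_
      rwa [(measurePreserving_eval (fun _ : Fin m => μ) i).map_eq]
    · congr 1
      simp
      field_simp
  have hcard : ∀ s : Fin m → Y,
      ((Finset.univ.filter fun i : Fin m => s i ∈ A).card : ℝ) = ∑ i, f (s i) := by
    intro s
    simp [f, Set.indicator_apply]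
  have hpos := tail _ (hf.sub_const _) hsub
  have hneg := tail _ (hf.sub_const _).neg hsub.neg
  calc _ ≤ (Measure.pi fun _ : Fin m => μ).real
        ({s | m * t ≤ ∑ i, (f (s i) - μ.real A)} ∪
          {s | m * t ≤ ∑ i, (-fun y => f y - μ.real A) (s i)}) := by
        refine measureReal_mono fun s hs => ?_
        simp only [Set.mem_ofPred_eq, hcard] at hs
        have heq : ∑ i, (f (s i) - μ.real A) = m * ((∑ i, f (s i)) / m - μ.real A) := by
          simp only [Finset.sum_sub_distrib, Finset.sum_const, Finset.card_univ, Fintype.card_fin,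
            nsmul_eq_mul]
          field_simp
        simp only [Set.mem_union, Set.mem_ofPred_eq, Pi.neg_apply, Finset.sum_neg_distrib, heq,
          ← mul_neg]
        exact (le_abs.mp hs).imp (fun h => by gcongr) (fun h => by gcongr)
    _ ≤ _ := measureReal_union_le _ _
    _ ≤ _ := by linarith

/-- uniform convergence of empirical disagreement rates.  The probability
under `μ_η^m` that some `h ∈ H` has `|d̂(h) - d(h)| ≥ ε(1-2η)/2` is at most
`2|H|·e^{-mε²(1-2η)²/2}`. -/
theorem uniform_convergence_noisy_disagreement
    {X : Type*} [MeasurableSpace X] (D : Measure X) [IsProbabilityMeasure D]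
    (c : X → Bool) (hc : Measurable c)
    (H : Finset (X → Bool)) (hHmeas : ∀ h ∈ H, Measurable h)
    (η ε : ℝ) (hη : η ∈ Set.Ico (0 : ℝ) (1 / 2)) (hε : ε ∈ Set.Ioo (0 : ℝ) 1)
    (m : ℕ) :
    (Measure.pi fun _ : Fin m => noisyExampleMeasure D c η)
      {s : Fin m → X × Bool | ∃ h ∈ H,
        ε * (1 - 2 * η) / 2 ≤
          |empDisagreement m h s -
            (noisyExampleMeasure D c η {p : X × Bool | h p.1 ≠ p.2}).toReal|}
      ≤ ENNReal.ofReal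
          (2 * (H.card : ℝ) * Real.exp (-(m : ℝ) * ε ^ 2 * (1 - 2 * η) ^ 2 / 2)) := by
  obtain ⟨hη0, hη1⟩ := hη
  have := isProbabilityMeasure_noisyExampleMeasure D hc hη0 (by linarith)
  have hset : {s : Fin m → X × Bool | ∃ h ∈ H, ε * (1 - 2 * η) / 2 ≤
      |empDisagreement m h s -
        (noisyExampleMeasure D c η {p : X × Bool | h p.1 ≠ p.2}).toReal|} =
      ⋃ h ∈ H, {s : Fin m → X × Bool | ε * (1 - 2 * η) / 2 ≤
        |empDisagreement m h s -
          (noisyExampleMeasure D c η {p : X × Bool | h p.1 ≠ p.2}).toReal|} := by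
    ext s
    simp
  have ht : 0 ≤ ε * (1 - 2 * η) / 2 :=
    div_nonneg (mul_nonneg hε.1.le (by linarith)) zero_le_two
  rw [hset, ← ofReal_measureReal (measure_ne_top _ _)]
  refine ENNReal.ofReal_le_ofReal ((measureReal_biUnion_finset_le _ _).trans ?_)
  refine (Finset.sum_le_card_nsmul H _ (2 * Real.exp (-2 * m * (ε * (1 - 2 * η) / 2) ^ 2))
    fun h hh => ?_).trans (le_of_eq ?_)
  · have hA : MeasurableSet {p : X × Bool | h p.1 ≠ p.2} :=
      (measurableSet_eq_fun ((hHmeas h hh).comp measurable_fst) measurable_snd).compl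
    exact measureReal_pi_le_abs_frequency_sub (noisyExampleMeasure D c η) hA m ht
  · rw [nsmul_eq_mul]
    ring_nf
end

section
/- Let X be a measurable space, D a probability measure on X, c : X → Bool a measurable target concept, H a finite set of measurable hypotheses containing c, η ∈ [0,1/2) a noise rate, and ε, δ ∈ (0,1). Suppose the sample size m satisfies m ≥ (2/(ε²·(1−2η)²))·ln(2|H|/δ). Draw m i.i.d. noisy examples from the classification-noise measure μ_η, and let ĥ ∈ H be any hypothesis minimizing the empirical disagreement rate d̂(h) = (1/m)·#{i : h(xᵢ) ≠ bᵢ} over H. Then with probability at least 1−δ, the output satisfies R(ĥ,c) ≤ ε. That is, the minimize-disagreement learner is an (ε,δ)-PAC learner from noisy data whenever m ≥ M_{b,η} = (2/(ε²(1−2η)²))·ln(2|H|/δ). -/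
open MeasureTheory

open ProbabilityTheory

/-- The 0-1 loss of the hypothesis `h` on a labeled example. -/
noncomputable def zeroOneLoss {X : Type*} (h : X → Bool) (p : X × Bool) : ℝ :=
  if h p.1 ≠ p.2 then 1 else 0

lemma zeroOneLoss_mem_Icc {X : Type*} (h : X → Bool) (p : X × Bool) :
    zeroOneLoss h p ∈ Set.Icc (0 : ℝ) 1 := by
  unfold zeroOneLoss
  split_ifs <;> simp

lemma empDisagreement_eq_sum {X : Type*} (m : ℕ) (h : X → Bool) (s : Fin m → X × Bool) :
    empDisagreement m h s = (∑ i, zeroOneLoss h (s i)) / m := by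
  simp only [empDisagreement, zeroOneLoss, Finset.sum_boole]

section Noise

variable {X : Type*} [MeasurableSpace X] {D : Measure X} {c h : X → Bool} {η : ℝ}

lemma measurable_zeroOneLoss (hh : Measurable h) : Measurable (zeroOneLoss h) := by
  have hne : MeasurableSet {p : X × Bool | h p.1 ≠ p.2} :=
    (measurableSet_eq_fun (hh.comp measurable_fst) measurable_snd).compl
  exact Measurable.ite hne measurable_const measurable_const

lemma noisyExampleMeasure_eq (hc : Measurable c) :
    noisyExampleMeasure D c η =
      ENNReal.ofReal (1 - η) • D.map (fun x => (x, c x)) +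
        ENNReal.ofReal η • D.map (fun x => (x, !c x)) := by
  have hclean : Measurable fun x => (x, c x) := measurable_id.prodMk hc
  have hflip : Measurable fun x => (x, !c x) :=
    measurable_id.prodMk ((measurable_of_finite Bool.not).comp hc)
  have hdirac {f : X → X × Bool} (hf : Measurable f) {A : Set (X × Bool)} (hA : MeasurableSet A) :
      Measurable fun x => Measure.dirac (f x) A :=
    (Measure.measurable_coe hA).comp (Measure.measurable_dirac.comp hf)
  have hker : Measurable fun x => ENNReal.ofReal (1 - η) • Measure.dirac (x, c x) +
      ENNReal.ofReal η • Measure.dirac (x, !c x) := by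
    refine Measure.measurable_of_measurable_coe _ fun A hA => ?_
    simp only [Measure.add_apply, Measure.smul_apply, smul_eq_mul]
    exact ((hdirac hclean hA).const_mul _).add ((hdirac hflip hA).const_mul _)
  have hmap {f : X → X × Bool} (hf : Measurable f) {A : Set (X × Bool)} (hA : MeasurableSet A) :
      ∫⁻ x, Measure.dirac (f x) A ∂D = D.map f A := by
    rw [← Measure.bind_dirac_eq_map D hf]
    exact (Measure.bind_apply hA (Measure.measurable_dirac.comp hf).aemeasurable).symm
  ext A hA
  rw [noisyExampleMeasure, Measure.bind_apply hA hker.aemeasurable]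
  simp only [Measure.add_apply, Measure.smul_apply, smul_eq_mul]
  rw [lintegral_add_left ((hdirac hclean hA).const_mul _),
    lintegral_const_mul _ (hdirac hclean hA), lintegral_const_mul _ (hdirac hflip hA),
    hmap hclean hA, hmap hflip hA]

lemma isProbabilityMeasure_noisyExampleMeasure_s10 [IsProbabilityMeasure D] (hc : Measurable c)
    (hη : η ∈ Set.Icc (0 : ℝ) 1) : IsProbabilityMeasure (noisyExampleMeasure D c η) := by
  have hclean : Measurable fun x => (x, c x) := measurable_id.prodMk hc
  have hflip : Measurable fun x => (x, !c x) :=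
    measurable_id.prodMk ((measurable_of_finite Bool.not).comp hc)
  constructor
  rw [noisyExampleMeasure_eq hc]
  simp only [Measure.add_apply, Measure.smul_apply, smul_eq_mul,
    Measure.map_apply hclean MeasurableSet.univ, Measure.map_apply hflip MeasurableSet.univ,
    Set.preimage_univ, measure_univ, mul_one]
  rw [← ENNReal.ofReal_add (by linarith [hη.2]) hη.1]
  simp

lemma integral_excess_loss [IsProbabilityMeasure D] (hc : Measurable c) (hh : Measurable h)
    (hη : η ∈ Set.Icc (0 : ℝ) 1) :
    ∫ p, (zeroOneLoss c p - zeroOneLoss h p) ∂noisyExampleMeasure D c η =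
      -((1 - 2 * η) * D.real {x | h x ≠ c x}) := by
  have hclean : Measurable fun x => (x, c x) := measurable_id.prodMk hc
  have hflip : Measurable fun x => (x, !c x) :=
    measurable_id.prodMk ((measurable_of_finite Bool.not).comp hc)
  have hmeas : Measurable fun p => zeroOneLoss c p - zeroOneLoss h p :=
    (measurable_zeroOneLoss hc).sub (measurable_zeroOneLoss hh)
  have hint (μ : Measure (X × Bool)) [IsFiniteMeasure μ] :
      Integrable (fun p => zeroOneLoss c p - zeroOneLoss h p) μ := by
    refine Integrable.of_mem_Icc (-1) 1 hmeas.aemeasurable (ae_of_all _ fun p => ?_)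
    have h₁ := zeroOneLoss_mem_Icc c p
    have h₂ := zeroOneLoss_mem_Icc h p
    exact ⟨by linarith [h₁.1, h₂.2], by linarith [h₁.2, h₂.1]⟩
  have hset : MeasurableSet {x | h x ≠ c x} := (measurableSet_eq_fun hh hc).compl
  have h_clean_val (x : X) : zeroOneLoss c (x, c x) - zeroOneLoss h (x, c x) =
      -Set.indicator {x | h x ≠ c x} 1 x := by
    by_cases hx : h x = c x <;> simp [zeroOneLoss, hx]
  have h_flip_val (x : X) : zeroOneLoss c (x, !c x) - zeroOneLoss h (x, !c x) =
      Set.indicator {x | h x ≠ c x} 1 x := by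
    cases hcx : c x <;> cases hhx : h x <;> simp [zeroOneLoss, hcx, hhx]
  rw [noisyExampleMeasure_eq hc, integral_add_measure
      ((hint _).smul_measure ENNReal.ofReal_ne_top) ((hint _).smul_measure ENNReal.ofReal_ne_top),
    integral_smul_measure, integral_smul_measure,
    integral_map hclean.aemeasurable hmeas.aestronglyMeasurable,
    integral_map hflip.aemeasurable hmeas.aestronglyMeasurable]
  simp only [h_clean_val, h_flip_val, integral_neg, integral_indicator_one hset, smul_eq_mul]
  rw [ENNReal.toReal_ofReal (by linarith [hη.2]), ENNReal.toReal_ofReal hη.1]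
  ring

end Noise

/-- Hoeffding's inequality for the sum of i.i.d. copies of a bounded random variable, whose
mean is at most `-t`, to be nonnegative. -/
lemma measureReal_pi_zero_le_sum_le {Ω : Type*} [MeasurableSpace Ω] {μ : Measure Ω}
    [IsProbabilityMeasure μ] {Y : Ω → ℝ} (hY : Measurable Y)
    (hb : ∀ ω, Y ω ∈ Set.Icc (-1 : ℝ) 1) {t : ℝ} (ht : 0 ≤ t) (hmean : ∫ ω, Y ω ∂μ ≤ -t) (m : ℕ) :
    (Measure.pi fun _ : Fin m => μ).real {s | 0 ≤ ∑ i, Y (s i)} ≤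
      Real.exp (-(m * t ^ 2 / 2)) := by
  have hsub (i : Fin m) : HasSubgaussianMGF (fun s : Fin m → Ω => Y (s i) - ∫ ω, Y ω ∂μ) 1
      (Measure.pi fun _ : Fin m => μ) := by
    have h := hasSubgaussianMGF_of_mem_Icc (μ := Measure.pi fun _ : Fin m => μ)
      (X := fun s => Y (s i)) (a := -1) (b := 1)
      (hY.comp (measurable_pi_apply i)).aemeasurable (ae_of_all _ fun s => hb (s i))
    rw [integral_comp_eval (μ := fun _ : Fin m => μ) hY.aestronglyMeasurable] at h
    convert! h
    rw [← NNReal.coe_inj]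
    norm_num
  have hindep : iIndepFun (fun (i : Fin m) (s : Fin m → Ω) => Y (s i) - ∫ ω, Y ω ∂μ)
      (Measure.pi fun _ : Fin m => μ) :=
    iIndepFun_pi (X := fun _ ω => Y ω - ∫ ω, Y ω ∂μ) fun _ => (hY.sub_const _).aemeasurable
  have hhoeff := HasSubgaussianMGF.measure_sum_ge_le_of_iIndepFun hindep (s := Finset.univ) (c := fun _ => 1)
    (fun i _ => hsub i) (ε := m * t) (by positivity)
  refine (measureReal_mono fun s hs => ?_).trans (hhoeff.trans_eq ?_)
  · have hs' : 0 ≤ ∑ i, Y (s i) := hs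
    simp only [Set.mem_ofPred_eq, Finset.sum_sub_distrib, Finset.sum_const, Finset.card_univ,
      Fintype.card_fin, nsmul_eq_mul]
    nlinarith [Nat.cast_nonneg (α := ℝ) m]
  · rcases Nat.eq_zero_or_pos m with rfl | hm
    · simp
    · have : (0 : ℝ) < m := by exact_mod_cast hm
      congr 1
      simp
      field_simp

/-- A hypothesis of error more than `ε` does at least as well as the target on the sample
with exponentially small probability. -/
lemma measureReal_empDisagreement_le {X : Type*} [MeasurableSpace X] {D : Measure X}
    [IsProbabilityMeasure D] {c g : X → Bool} (hc : Measurable c) (hg : Measurable g) {η ε : ℝ}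
    (hη : η ∈ Set.Ico (0 : ℝ) (1 / 2)) (hε : 0 ≤ ε) (hbad : ENNReal.ofReal ε < D {x | g x ≠ c x})
    {m : ℕ} (hm : 0 < m) :
    (Measure.pi fun _ : Fin m => noisyExampleMeasure D c η).real
        {s | empDisagreement m g s ≤ empDisagreement m c s} ≤
      Real.exp (-(m * ((1 - 2 * η) * ε) ^ 2 / 2)) := by
  have hη' : η ∈ Set.Icc (0 : ℝ) 1 := ⟨hη.1, by linarith [hη.2]⟩
  have := isProbabilityMeasure_noisyExampleMeasure_s10 (D := D) hc hη'
  have hnoise : 0 ≤ 1 - 2 * η := by linarith [hη.2]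
  have herr : ε ≤ D.real {x | g x ≠ c x} :=
    ((ENNReal.ofReal_lt_iff_lt_toReal hε (measure_ne_top _ _)).1 hbad).le
  refine le_trans (measureReal_mono fun s hs => ?_)
    (measureReal_pi_zero_le_sum_le (Y := fun p => zeroOneLoss c p - zeroOneLoss g p)
      ((measurable_zeroOneLoss hc).sub (measurable_zeroOneLoss hg)) (fun p => ?_)
      (mul_nonneg hnoise hε) ?_ m)
  · have hm' : (0 : ℝ) < m := by exact_mod_cast hm
    simpa [empDisagreement_eq_sum, div_le_div_iff_of_pos_right hm'] using hs
  · have h₁ := zeroOneLoss_mem_Icc c p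
    have h₂ := zeroOneLoss_mem_Icc g p
    exact ⟨by linarith [h₁.1, h₂.2], by linarith [h₁.2, h₂.1]⟩
  · rw [integral_excess_loss hc hg hη']
    gcongr

/-- the minimize-disagreement learner is an `(ε,δ)`-PAC learner from noisy
data whenever `m ≥ (2/(ε²(1-2η)²))·ln(2|H|/δ)`: with probability at least `1-δ` over
`μ_η^m`, every empirical-disagreement minimizer `ĥ ∈ H` satisfies `R(ĥ,c) ≤ ε`. -/
theorem minimize_disagreement_is_PAC
    {X : Type*} [MeasurableSpace X] (D : Measure X) [IsProbabilityMeasure D]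
    (c : X → Bool) (hc : Measurable c)
    (H : Finset (X → Bool)) (hcH : c ∈ H) (hHmeas : ∀ h ∈ H, Measurable h)
    (η ε δ : ℝ) (hη : η ∈ Set.Ico (0 : ℝ) (1 / 2))
    (hε : ε ∈ Set.Ioo (0 : ℝ) 1) (hδ : δ ∈ Set.Ioo (0 : ℝ) 1)
    (m : ℕ)
    (hm : 2 / (ε ^ 2 * (1 - 2 * η) ^ 2) * Real.log (2 * (H.card : ℝ) / δ) ≤ (m : ℝ)) :
    ENNReal.ofReal (1 - δ) ≤
      (Measure.pi fun _ : Fin m => noisyExampleMeasure D c η)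
        {s : Fin m → X × Bool | ∀ g ∈ H,
          (∀ h ∈ H, empDisagreement m g s ≤ empDisagreement m h s) →
            D {x | g x ≠ c x} ≤ ENNReal.ofReal ε} := by
  obtain ⟨hε₀, -⟩ := hε
  obtain ⟨hδ₀, hδ₁⟩ := hδ
  have hη' : η ∈ Set.Icc (0 : ℝ) 1 := ⟨hη.1, by linarith [hη.2]⟩
  have := isProbabilityMeasure_noisyExampleMeasure_s10 (D := D) hc hη'
  have hnoise : 0 < 1 - 2 * η := by linarith [hη.2]
  have hcard : (1 : ℝ) ≤ H.card := by exact_mod_cast Finset.card_pos.2 ⟨c, hcH⟩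
  have hlog : 0 < Real.log (2 * (H.card : ℝ) / δ) :=
    Real.log_pos (by rw [lt_div_iff₀ hδ₀]; linarith)
  have hm₀ : 0 < m := by
    have : (0 : ℝ) < m := lt_of_lt_of_le (by positivity) hm
    exact_mod_cast this
  have hexp : Real.exp (-(m * ((1 - 2 * η) * ε) ^ 2 / 2)) ≤ δ / (2 * H.card) := by
    rw [div_mul_eq_mul_div, div_le_iff₀ (by positivity)] at hm
    rw [← Real.le_log_iff_exp_le (by positivity), ← inv_div _ δ, Real.log_inv, neg_le_neg_iff]
    linarith
  set P := Measure.pi fun _ : Fin m => noisyExampleMeasure D c η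
  set S := {s : Fin m → X × Bool | ∀ g ∈ H,
    (∀ h ∈ H, empDisagreement m g s ≤ empDisagreement m h s) →
      D {x | g x ≠ c x} ≤ ENNReal.ofReal ε}
  classical
  set B := H.filter fun g => ENNReal.ofReal ε < D {x | g x ≠ c x}
  have hfail : P.real Sᶜ ≤ δ := calc
    P.real Sᶜ ≤ P.real (⋃ g ∈ B, {s | empDisagreement m g s ≤ empDisagreement m c s}) := by
      refine measureReal_mono (fun s hs => ?_) (measure_ne_top _ _)
      simp only [S, Set.mem_compl_iff, Set.mem_ofPred_eq, not_forall, not_le] at hs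
      obtain ⟨g, hg, hmin, hbad⟩ := hs
      exact Set.mem_biUnion (Finset.mem_filter.2 ⟨hg, hbad⟩) (hmin c hcH)
    _ ≤ ∑ g ∈ B, P.real {s | empDisagreement m g s ≤ empDisagreement m c s} :=
      measureReal_biUnion_finset_le _ _
    _ ≤ ∑ _g ∈ B, δ / (2 * H.card) := Finset.sum_le_sum fun g hg =>
      have hg' := Finset.mem_filter.1 hg
      (measureReal_empDisagreement_le hc (hHmeas g hg'.1) hη hε₀.le hg'.2 hm₀).trans hexp
    _ ≤ H.card * (δ / (2 * H.card)) := by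
      rw [Finset.sum_const, nsmul_eq_mul]
      gcongr
      exact Finset.filter_subset _ _
    _ ≤ δ := by
      field_simp
      linarith
  have hcover : 1 ≤ P.real S + P.real Sᶜ := by
    have h := measureReal_union_le (μ := P) S Sᶜ
    rwa [Set.union_compl_self, probReal_univ] at h
  rw [ENNReal.ofReal_le_iff_le_toReal (measure_ne_top _ _)]
  change 1 - δ ≤ P.real S
  linarith
end
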